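/- Sufficient δ for the label-release mechanism to be DP: let B be a pure ε-DP mechanism from datasets to distributions over Bool, and let L_B be the associated label-release mechanism (sample b_y ∼ B(D_y) independently for y ∈ labels(D) and output {y : b_y = true}). Suppose δ ∈ [0,1] satisfies, for every dataset D and every record (x*, y*) with y* ∉ labels(D) (writing D' = D with (x*, y*) added, q = Pr[B({(x*, y*)}) = false], and S* = {O ⊆ labels(D') : y* ∈ O}): δ ≥ max(1 − exp(ε)·q, 1/q − exp(ε), Pr[L_B(D') ∈ S*]). Then L_B is (ε, δ)-DP with respect to add/remove adjacency. -/

import Mathlib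

open scoped ENNReal

/-- Two datasets (multisets of records) are adjacent if one is obtained from
the other by adding a single record. -/
def Adjacent {α : Type*} (D D' : Multiset α) : Prop :=
  (∃ r, D' = r ::ₘ D) ∨ (∃ r, D = r ::ₘ D')

/-- `(ε, δ)`-differential privacy for a mechanism from datasets to PMFs:
for all adjacent datasets and every set `S` of outcomes,
`Pr[M(D) ∈ S] ≤ exp ε * Pr[M(D') ∈ S] + δ`. -/
def IsDP {α Ω : Type*} (M : Multiset α → PMF Ω) (ε δ : ℝ) : Prop :=
  ∀ D D' : Multiset α, Adjacent D D' → ∀ S : Set Ω,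
    (M D).toOuterMeasure S ≤
      ENNReal.ofReal (Real.exp ε) * (M D').toOuterMeasure S + ENNReal.ofReal δ

/-- The finite set of labels occurring in a dataset. -/
def labelsOf {X Y : Type*} [DecidableEq Y] (D : Multiset (X × Y)) : Finset Y :=
  (D.map Prod.snd).toFinset

/-- The sub-multiset `D_y` of records of `D` whose label equals `y`. -/
def classData {X Y : Type*} [DecidableEq Y] (D : Multiset (X × Y)) (y : Y) :
    Multiset (X × Y) :=
  D.filter (fun r => r.2 = y)

/-- Auxiliary: sample `b_y ~ B (D_y)` independently for each `y` in the list,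
keeping the labels for which `true` was sampled. -/
noncomputable def releaseAux {X Y : Type*} [DecidableEq Y]
    (B : Multiset (X × Y) → PMF Bool) (D : Multiset (X × Y)) :
    List Y → PMF (Finset Y)
  | [] => PMF.pure ∅
  | y :: ys => (B (classData D y)).bind fun b =>
      (releaseAux B D ys).map fun O => if b then insert y O else O

/-- The label-release mechanism `L_B` associated to a Boolean mechanism `B`:
output `{y ∈ labels(D) : b_y = true}` where the `b_y ~ B(D_y)` are sampled
independently for the distinct labels `y` of `D`. -/
noncomputable def labelRelease {X Y : Type*} [DecidableEq Y]
    (B : Multiset (X × Y) → PMF Bool) (D : Multiset (X × Y)) : PMF (Finset Y) :=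
  releaseAux B D (labelsOf D).toList

section

variable {X Y : Type*} [DecidableEq Y] (B : Multiset (X × Y) → PMF Bool)

theorem releaseAux_congr {D D' : Multiset (X × Y)} {l : List Y}
    (h : ∀ y ∈ l, classData D y = classData D' y) :
    releaseAux B D l = releaseAux B D' l := by
  induction l with
  | nil => rfl
  | cons y l ih =>
    simp only [releaseAux]
    rw [h y (by simp), ih fun z hz => h z (by simp [hz])]

theorem releaseAux_perm (D : Multiset (X × Y)) {l l' : List Y} (h : l.Perm l') :
    releaseAux B D l = releaseAux B D l' := by
  induction h with
  | nil => rfl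
  | cons y _ ih => simp only [releaseAux, ih]
  | swap y z l =>
    simp only [releaseAux, PMF.map_bind, PMF.map_comp]
    rw [PMF.bind_comm]
    refine congrArg _ (funext fun b => congrArg _ (funext fun c =>
      congrArg (PMF.map · _) (funext fun O => ?_)))
    cases b <;> cases c <;> simp [Finset.insert_comm]
  | trans _ _ ih₁ ih₂ => exact ih₁.trans ih₂

theorem labelRelease_eq_bind {D : Multiset (X × Y)} {y : Y} (hy : y ∈ labelsOf D) :
    labelRelease B D = (B (classData D y)).bind fun b =>
      (releaseAux B D ((labelsOf D).erase y).toList).map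
        fun O => if b then insert y O else O := by
  have h : (labelsOf D).toList.Perm (y :: ((labelsOf D).erase y).toList) := by
    have := Finset.toList_insert (Finset.notMem_erase y (labelsOf D))
    rwa [Finset.insert_erase hy] at this
  rw [labelRelease, releaseAux_perm B D h]
  rfl

theorem labelsOf_cons (r : X × Y) (D : Multiset (X × Y)) :
    labelsOf (r ::ₘ D) = insert r.2 (labelsOf D) := by
  simp [labelsOf]

theorem classData_cons_of_ne {r : X × Y} {y : Y} (h : y ≠ r.2) (D : Multiset (X × Y)) :
    classData (r ::ₘ D) y = classData D y :=
  Multiset.filter_cons_of_neg _ h.symm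

theorem classData_cons_self (r : X × Y) (D : Multiset (X × Y)) :
    classData (r ::ₘ D) r.2 = r ::ₘ classData D r.2 :=
  Multiset.filter_cons_of_pos _ rfl

theorem classData_eq_zero {D : Multiset (X × Y)} {y : Y} (h : y ∉ labelsOf D) :
    classData D y = 0 := by
  refine Multiset.filter_eq_nil.2 fun r hr hry => h ?_
  simp only [labelsOf, Multiset.mem_toFinset, Multiset.mem_map]
  exact ⟨r, hr, hry⟩

theorem labelRelease_cons (r : X × Y) (D : Multiset (X × Y)) :
    labelRelease B (r ::ₘ D) = (B (r ::ₘ classData D r.2)).bind fun b =>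
      (releaseAux B D ((labelsOf D).erase r.2).toList).map
        fun O => if b then insert r.2 O else O := by
  have h : (labelsOf (r ::ₘ D)).erase r.2 = (labelsOf D).erase r.2 := by
    rw [labelsOf_cons, Finset.erase_insert_eq_erase]
  rw [labelRelease_eq_bind B (y := r.2) (by simp [labelsOf_cons]), h, classData_cons_self,
    releaseAux_congr B (D := r ::ₘ D) (D' := D)]
  intro y hy
  exact classData_cons_of_ne (Finset.ne_of_mem_erase (Finset.mem_toList.1 hy)) D

theorem labelRelease_cons_of_notMem {r : X × Y} {D : Multiset (X × Y)}
    (h : r.2 ∉ labelsOf D) :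
    labelRelease B (r ::ₘ D) = (B {r}).bind fun b =>
      (labelRelease B D).map fun O => if b then insert r.2 O else O := by
  rw [labelRelease_cons, classData_eq_zero h, Finset.erase_eq_of_notMem h]
  rfl

theorem subset_of_mem_support_releaseAux {D : Multiset (X × Y)} {l : List Y} {O : Finset Y}
    (hO : O ∈ (releaseAux B D l).support) : O ⊆ l.toFinset := by
  induction l generalizing O with
  | nil => simp_all [releaseAux]
  | cons y l ih =>
    simp only [releaseAux, PMF.mem_support_bind_iff, PMF.support_map, Set.mem_image] at hO
    obtain ⟨b, -, P, hP, rfl⟩ := hO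
    rw [List.toFinset_cons]
    cases b
    · simpa using (ih hP).trans (Finset.subset_insert _ _)
    · simpa using Finset.insert_subset_insert y (ih hP)

theorem subset_of_mem_support_labelRelease {D : Multiset (X × Y)} {O : Finset Y}
    (hO : O ∈ (labelRelease B D).support) : O ⊆ labelsOf D := by
  simpa using subset_of_mem_support_releaseAux B hO

end

theorem PMF.toOuterMeasure_le_one {α : Type*} (p : PMF α) (S : Set α) :
    p.toOuterMeasure S ≤ 1 := by
  rw [← (p.toOuterMeasure_apply_eq_one_iff Set.univ).2 (Set.subset_univ _)]
  exact p.toOuterMeasure.mono (Set.subset_univ S)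

theorem PMF.toOuterMeasure_bind_bool {Ω : Type*} (p : PMF Bool) (f : Bool → PMF Ω)
    (S : Set Ω) :
    (p.bind f).toOuterMeasure S =
      p true * (f true).toOuterMeasure S + p false * (f false).toOuterMeasure S := by
  rw [PMF.toOuterMeasure_bind_apply, tsum_bool, add_comm]

/-- A mechanism that post-processes a pure differentially private Boolean mechanism inherits the
likelihood-ratio bound. -/
theorem IsDP.toOuterMeasure_bind_le {α Ω : Type*} {B : Multiset α → PMF Bool} {ε : ℝ}
    (hB : IsDP B ε 0) {D D' : Multiset α} (h : Adjacent D D') (f : Bool → PMF Ω) (S : Set Ω) :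
    ((B D).bind f).toOuterMeasure S ≤
      ENNReal.ofReal (Real.exp ε) * ((B D').bind f).toOuterMeasure S := by
  have hb (b : Bool) : B D b ≤ ENNReal.ofReal (Real.exp ε) * B D' b := by
    simpa [PMF.toOuterMeasure_apply_singleton] using hB D D' h {b}
  simp only [PMF.toOuterMeasure_bind_bool, mul_add, ← mul_assoc]
  gcongr <;> exact hb _

theorem Adjacent.symm {α : Type*} {D D' : Multiset α} (h : Adjacent D D') : Adjacent D' D :=
  Or.symm h

/-- Sufficient `δ` for the label-release mechanism to be DP: if `B` is pure
`ε`-DP and `δ ∈ [0,1]` dominates, for every dataset `D` and fresh-labelled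
record `(x, y)` (with `D' = D + {(x, y)}`, `q = Pr[B({(x, y)}) = false]`, and
`S* = {O ⊆ labels(D') : y ∈ O}`), the quantity
`max(1 − exp ε · q, 1/q − exp ε, Pr[L_B(D') ∈ S*])`, then `L_B` is `(ε, δ)`-DP. -/
theorem labelRelease_isDP_of_delta_bound {X Y : Type*} [Countable Y] [DecidableEq Y]
    (B : Multiset (X × Y) → PMF Bool) (ε : ℝ) (hε : 0 ≤ ε)
    (hB : IsDP B ε 0)
    (δ : ℝ) (hδ0 : 0 ≤ δ) (hδ1 : δ ≤ 1)
    (hδ : ∀ (D : Multiset (X × Y)) (x : X) (y : Y), y ∉ labelsOf D →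
      max (max (1 - Real.exp ε * ((B {(x, y)}) false).toReal)
            (1 / ((B {(x, y)}) false).toReal - Real.exp ε))
        ((labelRelease B ((x, y) ::ₘ D)).toOuterMeasure
          {O : Finset Y | O ⊆ labelsOf ((x, y) ::ₘ D) ∧ y ∈ O}).toReal ≤ δ) :
    IsDP (labelRelease B) ε δ := by
  have key (r : X × Y) (D : Multiset (X × Y)) (S : Set (Finset Y)) :
      (labelRelease B (r ::ₘ D)).toOuterMeasure S ≤
          ENNReal.ofReal (Real.exp ε) * (labelRelease B D).toOuterMeasure S + ENNReal.ofReal δ ∧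
        (labelRelease B D).toOuterMeasure S ≤
          ENNReal.ofReal (Real.exp ε) * (labelRelease B (r ::ₘ D)).toOuterMeasure S +
            ENNReal.ofReal δ := by
    by_cases hr : r.2 ∈ labelsOf D
    · have hadj : Adjacent (classData D r.2) (r ::ₘ classData D r.2) := Or.inl ⟨r, rfl⟩
      rw [labelRelease_cons, labelRelease_eq_bind B hr]
      exact ⟨(hB.toOuterMeasure_bind_le hadj.symm _ S).trans le_self_add,
        (hB.toOuterMeasure_bind_le hadj _ S).trans le_self_add⟩
    · have hδr := hδ D r.1 r.2 hr
      simp only [Prod.mk.eta, max_le_iff] at hδr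
      obtain ⟨⟨hq, -⟩, hp⟩ := hδr
      have hstar : (B {r}) true ≤ (labelRelease B (r ::ₘ D)).toOuterMeasure
          {O : Finset Y | O ⊆ labelsOf (r ::ₘ D) ∧ r.2 ∈ O} := by
        rw [labelRelease_cons_of_notMem B hr, PMF.toOuterMeasure_bind_bool]
        refine le_add_right (le_of_eq ?_)
        rw [(PMF.toOuterMeasure_apply_eq_one_iff _ _).2, mul_one]
        rw [PMF.support_map]
        rintro _ ⟨O, hO, rfl⟩
        have hsub := subset_of_mem_support_labelRelease B hO
        simpa [labelsOf_cons] using Finset.insert_subset_insert r.2 hsub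
      have hpδ : (B {r}) true ≤ ENNReal.ofReal δ := by
        refine hstar.trans ((ENNReal.le_ofReal_iff_toReal_le ?_ hδ0).2 hp)
        exact ((PMF.toOuterMeasure_le_one _ _).trans_lt ENNReal.one_lt_top).ne
      have hqδ : 1 ≤ ENNReal.ofReal (Real.exp ε) * (B {r}) false + ENNReal.ofReal δ := by
        rw [← ENNReal.ofReal_toReal ((B {r}).apply_ne_top false),
          ← ENNReal.ofReal_mul (Real.exp_nonneg ε),
          ← ENNReal.ofReal_add (by positivity) hδ0, ENNReal.one_le_ofReal]
        linarith
      have hexp : 1 ≤ ENNReal.ofReal (Real.exp ε) :=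
        ENNReal.one_le_ofReal.2 (Real.one_le_exp hε)
      have hsplit := PMF.toOuterMeasure_bind_bool (B {r})
        (fun b => (labelRelease B D).map fun O => if b then insert r.2 O else O) S
      rw [← labelRelease_cons_of_notMem B hr] at hsplit
      have hid : (labelRelease B D).map (fun O => if false = true then insert r.2 O else O) =
          labelRelease B D := by
        simp only [Bool.false_eq_true, if_false]
        exact PMF.map_id (labelRelease B D)
      rw [hid] at hsplit
      rw [hsplit]
      set P := (labelRelease B D).toOuterMeasure S
      have hP : P ≤ 1 := PMF.toOuterMeasure_le_one _ _
      constructor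
      · rw [add_comm]
        refine add_le_add ?_ ((mul_le_of_le_one_right' (PMF.toOuterMeasure_le_one _ _)).trans hpδ)
        gcongr
        exact ((B {r}).coe_le_one false).trans hexp
      · calc P = 1 * P := (one_mul P).symm
          _ ≤ (ENNReal.ofReal (Real.exp ε) * (B {r}) false + ENNReal.ofReal δ) * P := by gcongr
          _ = ENNReal.ofReal (Real.exp ε) * ((B {r}) false * P) + ENNReal.ofReal δ * P := by ring
          _ ≤ _ := by
            gcongr
            · exact le_add_self
            · exact mul_le_of_le_one_right' hP
  rintro D D' (⟨r, rfl⟩ | ⟨r, rfl⟩) S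
  · exact (key r D S).2
  · exact (key r D' S).1
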